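/- If 0 < α < 1 and n ≥ 2, then S = V is the unique Nash equilibrium of the SUM-game, and it minimizes the social cost; hence the price of anarchy is 1 in this range. -/

import Mathlib

open Finset

/-- Distance from a node `u` to the gateway set `S` (hop distance to nearest gateway). -/
noncomputable def gwDist {V : Type*} (G : SimpleGraph V) (S : Finset V) (u : V) : ℕ :=
  sInf ((fun s => G.dist u s) '' (S : Set V))

/-- Communication distance `δ_S(u,v) = min{d(u,v), d(u,S) + d(S,v)}`. -/
noncomputable def comDist {V : Type*} (G : SimpleGraph V) (S : Finset V) (u v : V) : ℕ :=
  min (G.dist u v) (gwDist G S u + gwDist G S v)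

/-- Private cost of node `v` in the SUM-game. -/
noncomputable def sumCost {V : Type*} [Fintype V] [DecidableEq V]
    (G : SimpleGraph V) (α : ℝ) (S : Finset V) (v : V) : ℝ :=
  (if v ∈ S then α else 0) + ∑ u : V, (comDist G S v u : ℝ)

/-- Social cost of the SUM-game. -/
noncomputable def sumSocial {V : Type*} [Fintype V] [DecidableEq V]
    (G : SimpleGraph V) (α : ℝ) (S : Finset V) : ℝ :=
  ∑ v : V, sumCost G α S v

/-- `v` performs an improving response changing profile `S` into `S'` in the SUM-game. -/
def SumIRBy {V : Type*} [Fintype V] [DecidableEq V]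
    (G : SimpleGraph V) (α : ℝ) (v : V) (S S' : Finset V) : Prop :=
  ((v ∉ S ∧ S' = insert v S) ∨ (v ∈ S ∧ S' = S.erase v ∧ (S.erase v).Nonempty)) ∧
    sumCost G α S' v < sumCost G α S v

/-- `S'` arises from `S` by an improving response in the SUM-game. -/
def SumIR {V : Type*} [Fintype V] [DecidableEq V]
    (G : SimpleGraph V) (α : ℝ) (S S' : Finset V) : Prop :=
  ∃ v, SumIRBy G α v S S'

/-- `S` is a Nash equilibrium of the SUM-game: no node has an improving response. -/
def SumNash {V : Type*} [Fintype V] [DecidableEq V]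
    (G : SimpleGraph V) (α : ℝ) (S : Finset V) : Prop :=
  ∀ S', ¬ SumIR G α S S'

theorem gwDist_le_dist {V : Type*} (G : SimpleGraph V) {S : Finset V} {s : V} (hs : s ∈ S)
    (u : V) : gwDist G S u ≤ G.dist u s :=
  Nat.sInf_le ⟨s, hs, rfl⟩

theorem gwDist_of_mem {V : Type*} (G : SimpleGraph V) {S : Finset V} {v : V} (hv : v ∈ S) :
    gwDist G S v = 0 := by
  simpa using gwDist_le_dist G hv v

theorem exists_gwDist_eq_dist {V : Type*} (G : SimpleGraph V) {S : Finset V} (hS : S.Nonempty)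
    (u : V) : ∃ s ∈ S, gwDist G S u = G.dist u s := by
  have hne : ((fun s => G.dist u s) '' (S : Set V)).Nonempty :=
    (Finset.coe_nonempty.mpr hS).image _
  obtain ⟨s, hs, h⟩ := Nat.sInf_mem hne
  exact ⟨s, hs, h.symm⟩

theorem gwDist_anti {V : Type*} (G : SimpleGraph V) {S T : Finset V} (hS : S.Nonempty)
    (hST : S ⊆ T) (u : V) : gwDist G T u ≤ gwDist G S u := by
  obtain ⟨s, hs, h⟩ := exists_gwDist_eq_dist G hS u
  exact h ▸ gwDist_le_dist G (hST hs) u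

theorem gwDist_pos {V : Type*} {G : SimpleGraph V} (hG : G.Connected) {S : Finset V}
    (hS : S.Nonempty) {v : V} (hv : v ∉ S) : 0 < gwDist G S v := by
  obtain ⟨s, hs, h⟩ := exists_gwDist_eq_dist G hS v
  exact h ▸ hG.pos_dist_of_ne fun hvs => hv (hvs ▸ hs)

theorem comDist_of_mem {V : Type*} (G : SimpleGraph V) {S : Finset V} {u v : V}
    (hu : u ∈ S) (hv : v ∈ S) : comDist G S u v = 0 := by
  simp [comDist, gwDist_of_mem G hu, gwDist_of_mem G hv]

theorem comDist_anti {V : Type*} (G : SimpleGraph V) {S T : Finset V} (hS : S.Nonempty)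
    (hST : S ⊆ T) (u v : V) : comDist G T u v ≤ comDist G S u v :=
  min_le_min le_rfl (add_le_add (gwDist_anti G hS hST u) (gwDist_anti G hS hST v))

theorem one_le_comDist {V : Type*} {G : SimpleGraph V} (hG : G.Connected) {S : Finset V}
    (hS : S.Nonempty) {u v : V} (hv : v ∉ S) (hvu : v ≠ u) : 1 ≤ comDist G S v u :=
  le_min (hG.pos_dist_of_ne hvu) (Nat.le_add_right_of_le (gwDist_pos hG hS hv))

theorem one_le_sumCost_of_notMem {V : Type*} [Fintype V] [DecidableEq V] {G : SimpleGraph V}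
    (hG : G.Connected) (α : ℝ) {S : Finset V} (hS : S.Nonempty) {v : V} (hv : v ∉ S) :
    1 ≤ sumCost G α S v := by
  obtain ⟨s, hs⟩ := hS
  rw [sumCost, if_neg hv, zero_add]
  calc (1 : ℝ) ≤ comDist G S v s := by
        exact_mod_cast one_le_comDist hG ⟨s, hs⟩ hv fun h => hv (h ▸ hs)
    _ ≤ ∑ u : V, (comDist G S v u : ℝ) :=
        Finset.single_le_sum (f := fun u => (comDist G S v u : ℝ))
          (fun _ _ => Nat.cast_nonneg _) (Finset.mem_univ s)

theorem le_sumCost_of_mem {V : Type*} [Fintype V] [DecidableEq V] (G : SimpleGraph V)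
    (α : ℝ) {S : Finset V} {v : V} (hv : v ∈ S) : α ≤ sumCost G α S v := by
  rw [sumCost, if_pos hv]
  exact le_add_of_nonneg_right (Finset.sum_nonneg fun _ _ => Nat.cast_nonneg _)

theorem sumCost_univ {V : Type*} [Fintype V] [DecidableEq V] (G : SimpleGraph V)
    (α : ℝ) (v : V) : sumCost G α Finset.univ v = α := by
  simp [sumCost, comDist_of_mem]

theorem sumCost_insert_lt {V : Type*} [Fintype V] [DecidableEq V] {G : SimpleGraph V}
    (hG : G.Connected) {α : ℝ} (hα1 : α < 1) {S : Finset V} (hS : S.Nonempty) {v : V}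
    (hv : v ∉ S) : sumCost G α (insert v S) v < sumCost G α S v := by
  obtain ⟨s, hs⟩ := hS
  have hsv : v ≠ s := fun h => hv (h ▸ hs)
  have hopen : comDist G (insert v S) v s = 0 :=
    comDist_of_mem G (Finset.mem_insert_self v S) (Finset.mem_insert_of_mem hs)
  have hclosed : (1 : ℝ) ≤ comDist G S v s := by
    exact_mod_cast one_le_comDist hG ⟨s, hs⟩ hv hsv
  have hrest : ∑ u ∈ Finset.univ.erase s, (comDist G (insert v S) v u : ℝ) ≤
      ∑ u ∈ Finset.univ.erase s, (comDist G S v u : ℝ) :=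
    Finset.sum_le_sum fun u _ => by
      exact_mod_cast comDist_anti G ⟨s, hs⟩ (Finset.subset_insert v S) v u
  rw [sumCost, sumCost, if_pos (Finset.mem_insert_self v S), if_neg hv,
    ← Finset.add_sum_erase _ _ (Finset.mem_univ s),
    ← Finset.add_sum_erase _ (fun u => (comDist G S v u : ℝ)) (Finset.mem_univ s), hopen]
  push_cast
  linarith

/-- If 0 < α < 1 and n ≥ 2, then S = V is the unique Nash equilibrium of the SUM-game and
it minimizes the social cost; hence the price of anarchy is 1 in this range. -/
theorem stmt_10 {V : Type*} [Fintype V] [DecidableEq V] (G : SimpleGraph V)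
    (hG : G.Connected) (α : ℝ) (hα : 0 < α) (hα1 : α < 1)
    (hn : 2 ≤ Fintype.card V) :
    SumNash G α Finset.univ ∧
    (∀ S : Finset V, S.Nonempty → SumNash G α S → S = Finset.univ) ∧
    (∀ S' : Finset V, S'.Nonempty →
      sumSocial G α Finset.univ ≤ sumSocial G α S') := by
  refine ⟨?_, fun S hS hN => ?_, fun S hS => Finset.sum_le_sum fun v _ => ?_⟩
  · rintro _ ⟨v, ⟨hv, -⟩ | ⟨-, rfl, hne⟩, hlt⟩
    · exact hv (Finset.mem_univ v)
    · rw [sumCost_univ] at hlt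
      linarith [one_le_sumCost_of_notMem hG α hne (Finset.notMem_erase v Finset.univ)]
  · refine Finset.eq_univ_iff_forall.mpr fun v => ?_
    by_contra hv
    exact hN _ ⟨v, Or.inl ⟨hv, rfl⟩, sumCost_insert_lt hG hα1 hS hv⟩
  · rw [sumCost_univ]
    by_cases hv : v ∈ S
    · exact le_sumCost_of_mem G α hv
    · exact hα1.le.trans (one_le_sumCost_of_notMem hG α hS hv)
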